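/- arXiv:2012.06821 — 2 statements merged into one kernel-verified Lean document; each statement's English description precedes it below -/
import Mathlib

section
/- Let n ≥ 2 be an even integer, let p, q be real numbers, and let S = {x ∈ ℝ : xⁿ − p·x + q = 0}. Set e(p) = (n−1)·|p/n|^{n/(n−1)}. Then S has exactly two elements if and only if q < e(p); S has exactly one element if and only if q = e(p); and S is empty if and only if q > e(p). Equivalently, S has exactly two, exactly one, or zero elements according as (p/n)ⁿ − (q/(n−1))^{n−1} is positive, zero, or negative. -/
theorem Odd.exists_real_pow_eq {m : ℕ} (hm : Odd m) (y : ℝ) : ∃ c : ℝ, c ^ m = y := by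
  have hm0 : m ≠ 0 := hm.pos.ne'
  rcases le_total 0 y with hy | hy
  · exact ⟨y ^ (m : ℝ)⁻¹, Real.rpow_inv_natCast_pow hy hm0⟩
  · refine ⟨-(-y) ^ (m : ℝ)⁻¹, ?_⟩
    rw [hm.neg_pow, Real.rpow_inv_natCast_pow (neg_nonneg.2 hy) hm0, neg_neg]

theorem StrictConvexOn.lt_of_hasDerivAt_zero {f : ℝ → ℝ} (hf : StrictConvexOn ℝ Set.univ f)
    {c : ℝ} (hc : HasDerivAt f 0 c) {x : ℝ} (hx : x ≠ c) : f c < f x := by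
  rcases hx.lt_or_gt with h | h
  · have h1 := hf.slope_lt_of_hasDerivAt (Set.mem_univ x) (Set.mem_univ c) h hc
    rw [slope_def_field, div_lt_iff₀ (sub_pos.2 h)] at h1
    linarith
  · have h1 := hf.lt_slope_of_hasDerivAt (Set.mem_univ c) (Set.mem_univ x) h hc
    rw [slope_def_field, lt_div_iff₀ (sub_pos.2 h)] at h1
    linarith

theorem StrictConvexOn.not_three_zeros {f : ℝ → ℝ} (hf : StrictConvexOn ℝ Set.univ f)
    {x y z : ℝ} (hxy : x < y) (hyz : y < z) (hx : f x = 0) (hy : f y = 0) (hz : f z = 0) :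
    False := by
  simpa [hx, hy, hz] using
    hf.slope_strict_mono_adjacent (Set.mem_univ x) (Set.mem_univ z) hxy hyz

theorem StrictConvexOn.encard_zeros_eq_two {f : ℝ → ℝ} (hf : StrictConvexOn ℝ Set.univ f)
    (hcont : Continuous f) {a c b : ℝ} (hac : a < c) (hcb : c < b)
    (ha : 0 < f a) (hc : f c < 0) (hb : 0 < f b) : {x | f x = 0}.encard = 2 := by
  obtain ⟨u, ⟨-, huc⟩, hu⟩ :=
    intermediate_value_Ioo' hac.le hcont.continuousOn (Set.mem_Ioo.2 ⟨hc, ha⟩)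
  obtain ⟨v, ⟨hcv, -⟩, hv⟩ :=
    intermediate_value_Ioo hcb.le hcont.continuousOn (Set.mem_Ioo.2 ⟨hc, hb⟩)
  have huv : u < v := huc.trans hcv
  refine Set.encard_eq_two.2 ⟨u, v, huv.ne, ?_⟩
  ext x
  simp only [Set.mem_ofPred_eq, Set.mem_insert_iff, Set.mem_singleton_iff]
  refine ⟨fun hx => ?_, ?_⟩
  · by_contra! hne
    rcases hne.1.lt_or_gt with h | h
    · exact hf.not_three_zeros h huv hx hu hv
    · rcases hne.2.lt_or_gt with h' | h'
      · exact hf.not_three_zeros h h' hu hx hv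
      · exact hf.not_three_zeros huv h' hu hv hx
  · rintro (rfl | rfl) <;> assumption

theorem strictConvexOn_pow_sub_mul_add {n : ℕ} (hn : 2 ≤ n) (hne : Even n) (p q : ℝ) :
    StrictConvexOn ℝ Set.univ fun x : ℝ => x ^ n - p * x + q := by
  have hlin : ConvexOn ℝ Set.univ fun x : ℝ => -p * x + q :=
    ⟨convex_univ, fun x _ y _ a b _ _ hab => by
      simp only [smul_eq_mul]
      exact le_of_eq (by linear_combination (-q) * hab)⟩
  have heq : (fun x : ℝ => x ^ n - p * x + q) = (fun x => x ^ n) + fun x => -p * x + q := by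
    funext x
    simp only [Pi.add_apply]
    ring
  rw [heq]
  exact (hne.strictConvexOn_pow (by omega)).add_convexOn hlin

theorem hasDerivAt_pow_sub_mul_add (n : ℕ) (p q x : ℝ) :
    HasDerivAt (fun x : ℝ => x ^ n - p * x + q) (n * x ^ (n - 1) - p) x := by
  simpa using (((hasDerivAt_pow n x).sub ((hasDerivAt_id x).const_mul p)).add_const q)

theorem pow_sub_mul_add_pos {n : ℕ} (hn : 2 ≤ n) (hne : Even n) {p q x : ℝ}
    (hx : 1 + |p| + |q| ≤ |x|) : 0 < x ^ n - p * x + q := by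
  have h1 : 1 ≤ |x| := by linarith [abs_nonneg p, abs_nonneg q]
  have h2 : |x| ^ 2 ≤ x ^ n := by
    rw [← hne.pow_abs x]
    exact pow_le_pow_right₀ h1 hn
  have h3 : p * x ≤ |p| * |x| := (le_abs_self _).trans (abs_mul p x).le
  nlinarith [neg_abs_le q, abs_nonneg q, abs_nonneg p]

/-- The number of real zeros of `x ^ n - p * x + q`, in terms of the critical point `c`. -/
theorem zeros_pow_sub_mul_add {n : ℕ} (hn : 2 ≤ n) (hne : Even n) {p q c : ℝ}
    (hc : n * c ^ (n - 1) = p) :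
    (q < (n - 1) * c ^ n → {x : ℝ | x ^ n - p * x + q = 0}.encard = 2) ∧
    (q = (n - 1) * c ^ n → {x : ℝ | x ^ n - p * x + q = 0}.encard = 1) ∧
    ((n - 1) * c ^ n < q → {x : ℝ | x ^ n - p * x + q = 0} = ∅) := by
  have hconv := strictConvexOn_pow_sub_mul_add hn hne p q
  have hderiv := hasDerivAt_pow_sub_mul_add n p q c
  rw [hc, sub_self] at hderiv
  have hval : c ^ n - p * c + q = q - (n - 1) * c ^ n := by
    have : c ^ n = c ^ (n - 1) * c := by rw [← pow_succ]; congr 1; omega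
    rw [← hc, this]
    ring
  have hmin : ∀ x, x ≠ c → c ^ n - p * c + q < x ^ n - p * x + q :=
    fun x hx => hconv.lt_of_hasDerivAt_zero hderiv hx
  refine ⟨fun hq => ?_, fun hq => ?_, fun hq => ?_⟩
  · have hM : 0 ≤ 1 + |p| + |q| := by positivity
    refine hconv.encard_zeros_eq_two (a := -(1 + |p| + |q| + |c|) - 1) (c := c)
      (b := 1 + |p| + |q| + |c| + 1) (by fun_prop) ?_ ?_ ?_ ?_ ?_
    · linarith [neg_abs_le c]
    · linarith [le_abs_self c]
    · refine pow_sub_mul_add_pos hn hne ?_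
      exact le_trans (by linarith [abs_nonneg c]) (neg_le_abs _)
    · linarith
    · refine pow_sub_mul_add_pos hn hne ?_
      exact le_trans (by linarith [abs_nonneg c]) (le_abs_self _)
  · refine Set.encard_eq_one.2 ⟨c, Set.eq_singleton_iff_unique_mem.2 ⟨?_, fun x hx => ?_⟩⟩
    · simp only [Set.mem_ofPred_eq]
      linarith
    · by_contra hxc
      have := hmin x hxc
      simp only [Set.mem_ofPred_eq] at hx
      linarith
  · refine Set.eq_empty_iff_forall_notMem.2 fun x hx => ?_
    simp only [Set.mem_ofPred_eq] at hx
    rcases eq_or_ne x c with rfl | hxc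
    · linarith
    · linarith [hmin x hxc]

theorem abs_pow_rpow_div {n : ℕ} (hn : 2 ≤ n) (hne : Even n) (c : ℝ) :
    |c ^ (n - 1)| ^ ((n : ℝ) / ((n : ℝ) - 1)) = c ^ n := by
  have hcast : ((n - 1 : ℕ) : ℝ) = (n : ℝ) - 1 := by
    rw [Nat.cast_sub (by omega), Nat.cast_one]
  have hpos : (n : ℝ) - 1 ≠ 0 := by
    rw [← hcast]
    exact Nat.cast_ne_zero.2 (by omega)
  rw [abs_pow, ← Real.rpow_natCast, ← Real.rpow_mul (abs_nonneg c), hcast,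
    mul_div_cancel₀ _ hpos, Real.rpow_natCast, hne.pow_abs]


/-- For even `n ≥ 2`, with `e(p) = (n−1)·|p/n|^{n/(n−1)}`, the equation
`xⁿ − p·x + q = 0` has exactly two, exactly one, or no real solutions according as
`q < e(p)`, `q = e(p)`, or `q > e(p)`; equivalently, according as the discriminant
`(p/n)ⁿ − (q/(n−1))^{n−1}` is positive, zero, or negative. -/
theorem even_degree_solution_count (n : ℕ) (hn : 2 ≤ n) (hne : Even n) (p q : ℝ) :
    ({x : ℝ | x ^ n - p * x + q = 0}.encard = 2 ↔
      q < (n - 1 : ℝ) * |p / n| ^ ((n : ℝ) / ((n : ℝ) - 1))) ∧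
    ({x : ℝ | x ^ n - p * x + q = 0}.encard = 1 ↔
      q = (n - 1 : ℝ) * |p / n| ^ ((n : ℝ) / ((n : ℝ) - 1))) ∧
    ({x : ℝ | x ^ n - p * x + q = 0} = ∅ ↔
      q > (n - 1 : ℝ) * |p / n| ^ ((n : ℝ) / ((n : ℝ) - 1))) ∧
    ({x : ℝ | x ^ n - p * x + q = 0}.encard = 2 ↔
      0 < (p / n) ^ n - (q / (n - 1 : ℝ)) ^ (n - 1)) ∧
    ({x : ℝ | x ^ n - p * x + q = 0}.encard = 1 ↔
      (p / n) ^ n - (q / (n - 1 : ℝ)) ^ (n - 1) = 0) ∧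
    ({x : ℝ | x ^ n - p * x + q = 0} = ∅ ↔
      (p / n) ^ n - (q / (n - 1 : ℝ)) ^ (n - 1) < 0) := by
  have hn1 : (0 : ℝ) < (n : ℝ) - 1 := by
    have : (2 : ℝ) ≤ n := by exact_mod_cast hn
    linarith
  have hn0 : (n : ℝ) ≠ 0 := by linarith
  have hodd : Odd (n - 1) := Nat.Even.sub_odd (by omega) hne odd_one
  obtain ⟨c, hc⟩ := hodd.exists_real_pow_eq (p / n)
  have hcp : n * c ^ (n - 1) = p := by
    rw [hc]
    field_simp
  obtain ⟨htwo, hone, hnone⟩ := zeros_pow_sub_mul_add (q := q) hn hne hcp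
  have hdisc : (p / n) ^ n = (c ^ n) ^ (n - 1) := by
    rw [← hc, ← pow_mul, ← pow_mul, mul_comm]
  have hmono := hodd.strictMono_pow (R := ℝ)
  have hpos : 0 < (p / n) ^ n - (q / (n - 1 : ℝ)) ^ (n - 1) ↔ q < (n - 1 : ℝ) * c ^ n := by
    rw [hdisc, sub_pos, hmono.lt_iff_lt, div_lt_iff₀' hn1]
  have hzero : (p / n) ^ n - (q / (n - 1 : ℝ)) ^ (n - 1) = 0 ↔ q = (n - 1 : ℝ) * c ^ n := by
    rw [hdisc, sub_eq_zero, eq_comm, hmono.injective.eq_iff, div_eq_iff hn1.ne', mul_comm]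
  have hneg : (p / n) ^ n - (q / (n - 1 : ℝ)) ^ (n - 1) < 0 ↔ (n - 1 : ℝ) * c ^ n < q := by
    rw [hdisc, sub_neg, hmono.lt_iff_lt, lt_div_iff₀' hn1]
  rw [hpos, hzero, hneg, ← hc, abs_pow_rpow_div hn hne, gt_iff_lt]
  generalize {x : ℝ | x ^ n - p * x + q = 0} = S at *
  have key : (S.encard = 2 ↔ q < (n - 1 : ℝ) * c ^ n) ∧
      (S.encard = 1 ↔ q = (n - 1 : ℝ) * c ^ n) ∧ (S = ∅ ↔ (n - 1 : ℝ) * c ^ n < q) := by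
    rw [← Set.encard_eq_zero] at hnone ⊢
    rcases lt_trichotomy q ((n - 1 : ℝ) * c ^ n) with h | h | h
    · simp [htwo h, h, h.ne, h.not_gt]
    · rw [hone h, ← h]
      simp
    · simp [hnone h, h, h.ne', h.not_gt]
  exact ⟨key.1, key.2.1, key.2.2, key⟩
end

section
/- Let n ≥ 3 be an odd integer, let p, q be real numbers with (p,q) ≠ (0,0), and let S = {x ∈ ℝ : xⁿ − p·x + q = 0}. Then S has exactly three elements if and only if (q/(n−1))^{n−1} < (p/n)ⁿ; S has exactly two elements if and only if (q/(n−1))^{n−1} = (p/n)ⁿ; and S has exactly one element if and only if (q/(n−1))^{n−1} > (p/n)ⁿ. Equivalently, writing e(p) = (n−1)·(p/n)^{n/(n−1)} for p ≥ 0, the equation has three, two, or one real solution(s) according as |q| < e(p) (with p > 0), |q| = e(p) (with p > 0), or otherwise. -/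
open Set

section UpDownUp

variable {f : ℝ → ℝ} {a b : ℝ}

lemma exists_zero_lt_of_pos {x : ℝ} (hf : Continuous f) (hneg : ∀ x, ∃ y < x, f y < 0)
    (hx : 0 < f x) : ∃ y < x, f y = 0 := by
  obtain ⟨z, hzx, hz⟩ := hneg x
  obtain ⟨y, hy, hy0⟩ := intermediate_value_Ioo hzx.le hf.continuousOn ⟨hz, hx⟩
  exact ⟨y, hy.2, hy0⟩

lemma exists_zero_gt_of_neg {x : ℝ} (hf : Continuous f) (hpos : ∀ x, ∃ y > x, 0 < f y)
    (hx : f x < 0) : ∃ y > x, f y = 0 := by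
  obtain ⟨z, hxz, hz⟩ := hpos x
  obtain ⟨y, hy, hy0⟩ := intermediate_value_Ioo (le_of_lt hxz) hf.continuousOn ⟨hx, hz⟩
  exact ⟨y, hy.1, hy0⟩

lemma encard_zeros_of_strictMono (hf : Continuous f) (hneg : ∀ x, ∃ y < x, f y < 0)
    (hpos : ∀ x, ∃ y > x, 0 < f y) (hmono : StrictMono f) : {x | f x = 0}.encard = 1 := by
  obtain ⟨z, -, hz⟩ := hneg 0
  obtain ⟨y, -, hy⟩ := exists_zero_gt_of_neg hf hpos hz
  refine encard_eq_one.2 ⟨y, ?_⟩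
  ext x
  exact ⟨fun hx => hmono.injective (hx.trans hy.symm), fun hx => hx ▸ hy⟩

lemma encard_zeros_eq_three (hf : Continuous f) (hneg : ∀ x, ∃ y < x, f y < 0)
    (hpos : ∀ x, ∃ y > x, 0 < f y) (hab : a < b) (hl : StrictMonoOn f (Iic a))
    (hm : StrictAntiOn f (Icc a b)) (hr : StrictMonoOn f (Ici b)) (ha : 0 < f a)
    (hb : f b < 0) : {x | f x = 0}.encard = 3 := by
  obtain ⟨x, hxa, hx⟩ := exists_zero_lt_of_pos hf hneg ha
  obtain ⟨y, ⟨hay, hyb⟩, hy⟩ := intermediate_value_Ioo' hab.le hf.continuousOn ⟨hb, ha⟩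
  obtain ⟨z, hbz, hz⟩ := exists_zero_gt_of_neg hf hpos hb
  refine encard_eq_three.2 ⟨x, y, z, by grind, by grind, by grind, ?_⟩
  ext w
  refine ⟨fun hw => ?_, by rintro (rfl | rfl | rfl) <;> assumption⟩
  rcases le_total w a with h | h
  · exact .inl (hl.injOn h hxa.le (hw.trans hx.symm))
  rcases le_total w b with h' | h'
  · exact .inr (.inl (hm.injOn ⟨h, h'⟩ ⟨hay.le, hyb.le⟩ (hw.trans hy.symm)))
  · exact .inr (.inr (hr.injOn h' (le_of_lt hbz) (hw.trans hz.symm)))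

lemma encard_zeros_of_left_eq (hf : Continuous f) (hpos : ∀ x, ∃ y > x, 0 < f y)
    (hab : a < b) (hl : StrictMonoOn f (Iic a)) (hm : StrictAntiOn f (Icc a b))
    (hr : StrictMonoOn f (Ici b)) (ha : f a = 0) : {x | f x = 0}.encard = 2 := by
  have hb : f b < 0 := ha ▸ hm (left_mem_Icc.2 hab.le) (right_mem_Icc.2 hab.le) hab
  obtain ⟨z, hbz, hz⟩ := exists_zero_gt_of_neg hf hpos hb
  refine encard_eq_two.2 ⟨a, z, by grind, ?_⟩
  ext w
  refine ⟨fun hw => ?_, by rintro (rfl | rfl) <;> assumption⟩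
  rcases le_total w a with h | h
  · exact .inl (hl.injOn h self_mem_Iic (hw.trans ha.symm))
  rcases le_total w b with h' | h'
  · exact .inl (hm.injOn ⟨h, h'⟩ (left_mem_Icc.2 hab.le) (hw.trans ha.symm))
  · exact .inr (hr.injOn h' (le_of_lt hbz) (hw.trans hz.symm))

lemma encard_zeros_of_right_eq (hf : Continuous f) (hneg : ∀ x, ∃ y < x, f y < 0)
    (hab : a < b) (hl : StrictMonoOn f (Iic a)) (hm : StrictAntiOn f (Icc a b))
    (hr : StrictMonoOn f (Ici b)) (hb : f b = 0) : {x | f x = 0}.encard = 2 := by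
  have ha : 0 < f a := hb ▸ hm (left_mem_Icc.2 hab.le) (right_mem_Icc.2 hab.le) hab
  obtain ⟨z, hza, hz⟩ := exists_zero_lt_of_pos hf hneg ha
  refine encard_eq_two.2 ⟨z, b, by grind, ?_⟩
  ext w
  refine ⟨fun hw => ?_, by rintro (rfl | rfl) <;> assumption⟩
  rcases le_total w a with h | h
  · exact .inl (hl.injOn h hza.le (hw.trans hz.symm))
  rcases le_total w b with h' | h'
  · exact .inr (hm.injOn ⟨h, h'⟩ (right_mem_Icc.2 hab.le) (hw.trans hb.symm))
  · exact .inr (hr.injOn h' self_mem_Ici (hw.trans hb.symm))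

lemma encard_zeros_of_left_neg (hf : Continuous f) (hpos : ∀ x, ∃ y > x, 0 < f y)
    (hab : a < b) (hl : StrictMonoOn f (Iic a)) (hm : StrictAntiOn f (Icc a b))
    (hr : StrictMonoOn f (Ici b)) (ha : f a < 0) : {x | f x = 0}.encard = 1 := by
  have hb : f b < 0 := (hm (left_mem_Icc.2 hab.le) (right_mem_Icc.2 hab.le) hab).trans ha
  obtain ⟨z, hbz, hz⟩ := exists_zero_gt_of_neg hf hpos hb
  refine encard_eq_one.2 ⟨z, ?_⟩
  ext w
  refine ⟨fun hw => ?_, by rintro rfl; assumption⟩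
  have hw' : f w = 0 := hw
  rcases le_total w a with h | h
  · linarith [hl.monotoneOn h self_mem_Iic h]
  rcases le_total w b with h' | h'
  · linarith [hm.antitoneOn (left_mem_Icc.2 hab.le) ⟨h, h'⟩ h]
  · exact hr.injOn h' (le_of_lt hbz) (hw.trans hz.symm)

lemma encard_zeros_of_right_pos (hf : Continuous f) (hneg : ∀ x, ∃ y < x, f y < 0)
    (hab : a < b) (hl : StrictMonoOn f (Iic a)) (hm : StrictAntiOn f (Icc a b))
    (hr : StrictMonoOn f (Ici b)) (hb : 0 < f b) : {x | f x = 0}.encard = 1 := by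
  have ha : 0 < f a := hb.trans (hm (left_mem_Icc.2 hab.le) (right_mem_Icc.2 hab.le) hab)
  obtain ⟨z, hza, hz⟩ := exists_zero_lt_of_pos hf hneg ha
  refine encard_eq_one.2 ⟨z, ?_⟩
  ext w
  refine ⟨fun hw => ?_, by rintro rfl; assumption⟩
  have hw' : f w = 0 := hw
  rcases le_total w a with h | h
  · exact hl.injOn h hza.le (hw.trans hz.symm)
  rcases le_total w b with h' | h'
  · linarith [hm.antitoneOn ⟨h, h'⟩ (right_mem_Icc.2 hab.le) h']
  · linarith [hr.monotoneOn self_mem_Ici h' h']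

end UpDownUp

section Trinomial

variable {n : ℕ}

lemma exists_gt_trinomial_pos (hn : 3 ≤ n) (p q x : ℝ) :
    ∃ y > x, 0 < y ^ n - p * y + q := by
  set y := |x| + |p| + |q| + 1 with hy
  have h1 : 1 ≤ y := by linarith [abs_nonneg x, abs_nonneg p, abs_nonneg q]
  refine ⟨y, by linarith [le_abs_self x, abs_nonneg p, abs_nonneg q], ?_⟩
  have h2 : y ^ 2 ≤ y ^ n := pow_le_pow_right₀ h1 (by omega)
  have h3 : |q| + 1 ≤ y - p := by linarith [le_abs_self p, abs_nonneg x]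
  nlinarith [neg_abs_le q, abs_nonneg q, mul_le_mul h1 h3 (by positivity) (by linarith)]

lemma exists_lt_trinomial_neg (hn : 3 ≤ n) (hno : Odd n) (p q x : ℝ) :
    ∃ y < x, y ^ n - p * y + q < 0 := by
  obtain ⟨y, hy, h⟩ := exists_gt_trinomial_pos hn p (-q) (-x)
  refine ⟨-y, by linarith, ?_⟩
  rw [hno.neg_pow]
  linarith

lemma deriv_trinomial (p q x : ℝ) :
    deriv (fun x : ℝ => x ^ n - p * x + q) x = n * x ^ (n - 1) - p := by
  have := (((hasDerivAt_pow n x).sub ((hasDerivAt_id x).const_mul p)).add_const q).deriv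
  simpa using this

end Trinomial

/-- For odd `n ≥ 3` and `(p,q) ≠ (0,0)`, the equation `xⁿ − p·x + q = 0` has exactly
three, exactly two, or exactly one real solution(s) according as `(q/(n−1))^{n−1}` is
`<`, `=`, or `>` `(p/n)ⁿ`. -/
theorem odd_degree_solution_count (n : ℕ) (hn : 3 ≤ n) (hno : Odd n) (p q : ℝ)
    (hpq : (p, q) ≠ (0, 0)) :
    ({x : ℝ | x ^ n - p * x + q = 0}.encard = 3 ↔
      (q / (n - 1 : ℝ)) ^ (n - 1) < (p / n) ^ n) ∧
    ({x : ℝ | x ^ n - p * x + q = 0}.encard = 2 ↔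
      (q / (n - 1 : ℝ)) ^ (n - 1) = (p / n) ^ n) ∧
    ({x : ℝ | x ^ n - p * x + q = 0}.encard = 1 ↔
      (q / (n - 1 : ℝ)) ^ (n - 1) > (p / n) ^ n) := by
  have hn3 : (3 : ℝ) ≤ n := by exact_mod_cast hn
  have hn0 : n - 1 ≠ 0 := by omega
  have heven : Even (n - 1) := hno.tsub_odd odd_one
  have hcont : Continuous fun x : ℝ => x ^ n - p * x + q := by fun_prop
  have hpos := exists_gt_trinomial_pos hn p q
  have hneg := exists_lt_trinomial_neg hn hno p q
  suffices H :
      ((q / (n - 1 : ℝ)) ^ (n - 1) < (p / n) ^ n →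
        {x : ℝ | x ^ n - p * x + q = 0}.encard = 3) ∧
      ((q / (n - 1 : ℝ)) ^ (n - 1) = (p / n) ^ n →
        {x : ℝ | x ^ n - p * x + q = 0}.encard = 2) ∧
      ((p / n) ^ n < (q / (n - 1 : ℝ)) ^ (n - 1) →
        {x : ℝ | x ^ n - p * x + q = 0}.encard = 1) by
    obtain ⟨H3, H2, H1⟩ := H
    rcases lt_trichotomy ((q / (n - 1 : ℝ)) ^ (n - 1)) ((p / n) ^ n) with h | h | h
    · simp [H3 h, h, h.ne, h.le]
    · simp [H2 h, h]
    · simp [H1 h, h, h.ne', h.le]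
  rcases le_or_gt p 0 with hp | hp
  · have hlt : (p / n) ^ n < (q / (n - 1 : ℝ)) ^ (n - 1) := by
      rcases hp.lt_or_eq with hp | rfl
      · exact (hno.pow_neg (div_neg_of_neg_of_pos hp (by linarith))).trans_le
          (heven.pow_nonneg _)
      · have hq : q ≠ 0 := by rintro rfl; exact hpq rfl
        rw [zero_div, zero_pow (by omega)]
        exact heven.pow_pos (div_ne_zero hq (by linarith))
    have hmono : StrictMono fun x : ℝ => x ^ n - p * x + q := fun x y hxy => by
      have := hno.strictMono_pow hxy
      dsimp only at this ⊢
      nlinarith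
    exact ⟨fun h => absurd h hlt.not_gt, fun h => absurd h hlt.ne',
      fun _ => encard_zeros_of_strictMono hcont hneg hpos hmono⟩
  obtain ⟨a, ha, hap⟩ : ∃ a : ℝ, 0 < a ∧ a ^ (n - 1) = p / n :=
    ⟨(p / n) ^ ((n - 1 : ℕ) : ℝ)⁻¹, by positivity, Real.rpow_inv_natCast_pow (by positivity) hn0⟩
  have hpa : p = n * a ^ (n - 1) := by rw [hap]; field_simp
  have hpow : a ^ n = a ^ (n - 1) * a := (pow_sub_one_mul (by omega) a).symm
  have hfa : a ^ n - p * a + q = q - (n - 1) * a ^ n := by rw [hpa, hpow]; ring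
  have hfna : (-a) ^ n - p * (-a) + q = q + (n - 1) * a ^ n := by
    rw [hno.neg_pow, hpa, hpow]; ring
  have hlt : -a < a := by linarith
  have hl : StrictMonoOn (fun x : ℝ => x ^ n - p * x + q) (Iic (-a)) :=
    strictMonoOn_of_deriv_pos (convex_Iic _) hcont.continuousOn fun x hx => by
      rw [interior_Iic, mem_Iio] at hx
      have := pow_lt_pow_left₀ (lt_neg_of_lt_neg hx) ha.le hn0
      rw [heven.neg_pow] at this
      rw [deriv_trinomial]
      nlinarith
  have hr : StrictMonoOn (fun x : ℝ => x ^ n - p * x + q) (Ici a) :=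
    strictMonoOn_of_deriv_pos (convex_Ici _) hcont.continuousOn fun x hx => by
      rw [interior_Ici, mem_Ioi] at hx
      have := pow_lt_pow_left₀ hx ha.le hn0
      rw [deriv_trinomial]
      nlinarith
  have hm : StrictAntiOn (fun x : ℝ => x ^ n - p * x + q) (Icc (-a) a) :=
    strictAntiOn_of_deriv_neg (convex_Icc _ _) hcont.continuousOn fun x hx => by
      rw [interior_Icc, mem_Ioo, ← abs_lt] at hx
      have := pow_lt_pow_left₀ hx (abs_nonneg x) hn0
      rw [heven.pow_abs] at this
      rw [deriv_trinomial]
      nlinarith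
  have hn1 : (0 : ℝ) < n - 1 := by linarith
  have hqa : (q / (n - 1 : ℝ)) ^ (n - 1) = (|q| / (n - 1)) ^ (n - 1) := by
    rw [← heven.pow_abs, abs_div, abs_of_pos hn1]
  have hqnn : 0 ≤ |q| / ((n : ℝ) - 1) := by positivity
  have hann : 0 ≤ a ^ n := by positivity
  rw [hqa, ← hap, pow_right_comm]
  refine ⟨fun h => ?_, fun h => ?_, fun h => ?_⟩
  · rw [pow_lt_pow_iff_left₀ hqnn hann hn0, div_lt_iff₀' hn1, abs_lt] at h
    exact encard_zeros_eq_three hcont hneg hpos hlt hl hm hr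
      (by linarith) (by linarith)
  · rw [pow_left_inj₀ hqnn hann hn0, div_eq_iff hn1.ne', mul_comm,
      abs_eq (by positivity)] at h
    rcases h with h | h
    · exact encard_zeros_of_right_eq hcont hneg hlt hl hm hr (by linarith)
    · exact encard_zeros_of_left_eq hcont hpos hlt hl hm hr (by linarith)
  · rw [pow_lt_pow_iff_left₀ hann hqnn hn0, lt_div_iff₀' hn1, lt_abs] at h
    rcases h with h | h
    · exact encard_zeros_of_right_pos hcont hneg hlt hl hm hr (by linarith)
    · exact encard_zeros_of_left_neg hcont hpos hlt hl hm hr (by linarith)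
end
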